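/- Let Γ be a torsion-free discrete subgroup of PSL(2,ℂ) of finite covolume, contained in PSL(2,R) where R is a finitely generated subring of a number field k. Then every infinite cyclic subgroup H of Γ generated by a loxodromic element is closed in the congruence topology on Γ: for every γ ∈ Γ − H there is a non-zero ideal I of R such that the image of γ under the congruence homomorphism Γ → PSL(2,R/I) does not lie in the image of H. -/

import Mathlib

set_option synthInstance.maxHeartbeats 400000
set_option maxHeartbeats 800000

open Matrix MeasureTheory

/-- The special linear group `SL(2, ℂ)`, topologized as a subspace of the matrices. -/
abbrev SL2C := Matrix.SpecialLinearGroup (Fin 2) ℂ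

noncomputable instance : TopologicalSpace SL2C := instTopologicalSpaceSubtype

/-- `PSL(2, ℂ)`: the quotient of `SL(2, ℂ)` by its center `{±I}`. -/
abbrev PSL2C := SL2C ⧸ Subgroup.center SL2C

noncomputable instance : MeasurableSpace PSL2C := borel _

/-- A subset `X` of a group `G` is separable (closed in the profinite topology) if for
every `γ ∈ G − X` there is a homomorphism `φ` from `G` to a finite group with
`φ γ ∉ φ '' X`. -/
def IsSeparableSubset {G : Type} [Group G] (X : Set G) : Prop :=
  ∀ γ : G, γ ∉ X → ∃ (F : Type) (_ : Group F) (_ : Finite F) (φ : G →* F), φ γ ∉ φ '' X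

/-- A subgroup `Γ ≤ PSL(2, ℂ)` has finite covolume if, with respect to a Haar measure
`μ` on `PSL(2, ℂ)`, the action of `Γ` on `PSL(2, ℂ)` admits a fundamental domain of
finite measure (equivalently, the quotient carries an induced invariant measure of
finite total mass). -/
def HasFiniteCovolume (Γ : Subgroup PSL2C) : Prop :=
  ∃ μ : Measure PSL2C, μ.IsHaarMeasure ∧
    ∃ s : Set PSL2C, IsFundamentalDomain (↥Γ) s μ ∧ μ s ≠ ⊤

/-- A non-identity element of `PSL(2, ℂ)` is parabolic if its representatives in
`SL(2, ℂ)` have trace `±2`. -/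
def IsParabolic (x : PSL2C) : Prop :=
  x ≠ 1 ∧ ∃ A : SL2C, (QuotientGroup.mk A : PSL2C) = x ∧
    (Matrix.trace (A : Matrix (Fin 2) (Fin 2) ℂ) = 2 ∨
     Matrix.trace (A : Matrix (Fin 2) (Fin 2) ℂ) = -2)

/-- An element of `PSL(2, ℂ)` is loxodromic if the square of the trace of a
representative in `SL(2, ℂ)` is not a real number in the interval `[0, 4]`. -/
def IsLoxodromic (x : PSL2C) : Prop :=
  ∃ A : SL2C, (QuotientGroup.mk A : PSL2C) = x ∧
    ∀ r : ℝ, 0 ≤ r → r ≤ 4 → (Matrix.trace (A : Matrix (Fin 2) (Fin 2) ℂ)) ^ 2 ≠ (r : ℂ)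

/-- A maximal parabolic subgroup of `Γ ≤ PSL(2, ℂ)`: a subgroup all of whose
non-identity elements are parabolic, maximal among such subgroups of `Γ`. -/
def IsMaxParabolicSubgroup (Γ : Subgroup PSL2C) (P : Subgroup ↥Γ) : Prop :=
  (∀ x ∈ P, x ≠ 1 → IsParabolic (x : PSL2C)) ∧
  ∀ P' : Subgroup ↥Γ, (∀ x ∈ P', x ≠ 1 → IsParabolic (x : PSL2C)) → P ≤ P' → P' = P

/-- A maximal cyclic parabolic subgroup of `Γ ≤ PSL(2, ℂ)`: a cyclic subgroup
consisting of parabolic elements (and the identity), maximal among cyclic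
subgroups of `Γ`. -/
def IsMaxCyclicParabolicSubgroup (Γ : Subgroup PSL2C) (P : Subgroup ↥Γ) : Prop :=
  (∃ x : ↥Γ, P = Subgroup.zpowers x) ∧
  (∀ x ∈ P, x ≠ 1 → IsParabolic (x : PSL2C)) ∧
  ∀ P' : Subgroup ↥Γ, (∃ y : ↥Γ, P' = Subgroup.zpowers y) → P ≤ P' → P' = P

/-- A loxodromic subgroup of `Γ ≤ PSL(2, ℂ)`: an infinite cyclic subgroup generated
by a loxodromic element. -/
def IsLoxodromicSubgroup (Γ : Subgroup PSL2C) (H : Subgroup ↥Γ) : Prop :=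
  ∃ x : ↥Γ, IsLoxodromic (x : PSL2C) ∧ ¬IsOfFinOrder x ∧ H = Subgroup.zpowers x

/-- `PSL(2, R)` for a commutative ring `R`: `SL(2, R)` modulo its center. -/
abbrev PSL2 (R : Type) [CommRing R] :=
  Matrix.SpecialLinearGroup (Fin 2) R ⧸ Subgroup.center (Matrix.SpecialLinearGroup (Fin 2) R)

/-- `Γ ≤ PSL(2, ℂ)` is contained in `PSL(2, R)` for a subring `R ≤ ℂ`: every element of
`Γ` is represented by a matrix in `SL(2, R)`. -/
def ContainedInPSL2 (R : Subring ℂ) (Γ : Subgroup PSL2C) : Prop :=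
  ∀ x : ↥Γ, ∃ A : Matrix.SpecialLinearGroup (Fin 2) ↥R,
    (QuotientGroup.mk (Matrix.SpecialLinearGroup.map R.subtype A) : PSL2C) = (x : PSL2C)

/-- A subset `X` of `Γ ≤ PSL(2, ℂ)`, with `Γ ⊆ PSL(2, R)`, is closed in the congruence
topology on `Γ` (with respect to `R`) if for every `γ ∈ Γ − X` there is a non-zero
ideal `I` of `R` such that the image of `γ` under the congruence homomorphism
`Γ → PSL(2, R) → PSL(2, R/I)` does not lie in the image of `X`.  The congruence
homomorphism `η` is characterized by sending any element of `Γ` represented by a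
matrix `A ∈ SL(2, R)` to the class of the reduction of `A` modulo `I`. -/
def CongruenceClosed (R : Subring ℂ) (Γ : Subgroup PSL2C) (X : Set ↥Γ) : Prop :=
  ∀ γ : ↥Γ, γ ∉ X → ∃ I : Ideal ↥R, I ≠ ⊥ ∧
    ∃ η : ↥Γ →* PSL2 (↥R ⧸ I),
      (∀ (x : ↥Γ) (A : Matrix.SpecialLinearGroup (Fin 2) ↥R),
        (QuotientGroup.mk (Matrix.SpecialLinearGroup.map R.subtype A) : PSL2C) = (x : PSL2C) →
        η x = QuotientGroup.mk (Matrix.SpecialLinearGroup.map (Ideal.Quotient.mk I) A)) ∧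
      η γ ∉ η '' X

/-- `R` is a finitely generated subring of a number field (a subfield of `ℂ` that is
finite-dimensional over `ℚ`). -/
def IsFGSubringOfNumberField (R : Subring ℂ) : Prop :=
  (∃ s : Finset ℂ, R = Subring.closure ↑s) ∧
  ∃ k : Subfield ℂ, FiniteDimensional ℚ ↥k ∧ R ≤ k.toSubring

section Helpers

open Filter Topology Polynomial NumberField

/-- The powers of a fixed element of absolute value one take only finitely many values
up to any prescribed positive error. -/
def HasFiniteColorings {K : Type*} [Field K] (v : AbsoluteValue K ℝ) (x : K) : Prop :=
  ∀ ε > 0, ∃ (N : ℕ) (c : ℕ → Fin N),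
    ∀ m m' : ℕ, c m = c m' → v (x ^ m - x ^ m') < ε

lemma HasFiniteColorings.of_finite {K : Type*} [Field K] {v : AbsoluteValue K ℝ} {x : K}
    (h : ∀ ε > 0, ∃ (C : Type _) (_ : Finite C) (c : ℕ → C),
      ∀ m m' : ℕ, c m = c m' → v (x ^ m - x ^ m') < ε) : HasFiniteColorings v x := by
  intro ε hε
  obtain ⟨C, _, c, hc⟩ := h ε hε
  obtain ⟨N, ⟨e⟩⟩ := Finite.exists_equiv_fin C
  exact ⟨N, e ∘ c, fun m m' hm => hc m m' (e.injective hm)⟩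

lemma hasFiniteColorings_finitePlace {K : Type*} [Field K] [NumberField K]
    (w : FinitePlace K) (x : K) (hx : w x = 1) : HasFiniteColorings w.1 x := by
  refine .of_finite fun ε hε => ?_
  obtain ⟨v, rfl⟩ : ∃ v, FinitePlace.mk v = w := ⟨_, FinitePlace.mk_maximalIdeal w⟩
  have hval : ∀ y : K, (FinitePlace.mk v).1 y =
      WithZeroMulInt.toNNReal (HeightOneSpectrum.absNorm_ne_zero v) (v.valuation K y) := by
    intro y
    rw [← FinitePlace.norm_embedding' v y]; rfl
  have hmono := WithZeroMulInt.toNNReal_strictMono (HeightOneSpectrum.one_lt_absNorm_nnreal v)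
  have hint : ∀ r : 𝓞 K, (FinitePlace.mk v).1 (r : K) ≤ 1 := fun r =>
    FinitePlace.norm_le_one K v r
  obtain ⟨π, hπ, hπ0⟩ := Submodule.exists_mem_ne_zero_of_ne_bot v.ne_bot
  have hπ1 : (FinitePlace.mk v).1 (π : K) < 1 := (FinitePlace.norm_lt_one_iff_mem K v π).2 hπ
  obtain ⟨e, he⟩ := exists_pow_lt_of_lt_one hε hπ1
  set c : 𝓞 K := π ^ e with hc
  have hc0 : c ≠ 0 := pow_ne_zero _ hπ0
  have hcε : (FinitePlace.mk v).1 (c : K) < ε := by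
    rw [hc]; push_cast; rwa [map_pow]
  have hv1 : ∀ m : ℕ, v.valuation K (x ^ m) ≤ 1 := by
    intro m
    rw [← hmono.le_iff_le, map_one]
    have := hval (x ^ m)
    rw [map_pow] at this
    have h2 : (FinitePlace.mk v).1 x = 1 := hx
    rw [h2, one_pow] at this
    exact_mod_cast this.symm.le
  have hc0' : v.valuation K (c : K) ≠ 0 := by
    rw [Valuation.ne_zero_iff]; exact_mod_cast hc0
  have happ : ∀ m : ℕ, ∃ r : 𝓞 K, (FinitePlace.mk v).1 ((r : K) - x ^ m) < ε := by
    intro m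
    obtain ⟨r, hr⟩ := v.exists_valuation_sub_lt_of_integer (hv1 m) (Units.mk0 _ hc0')
    refine ⟨r, lt_trans ?_ hcε⟩
    rw [hval, hval]
    exact_mod_cast hmono hr
  choose r hr using happ
  refine ⟨𝓞 K ⧸ Ideal.span ({c} : Set (𝓞 K)), ?_, fun m => Ideal.Quotient.mk _ (r m), ?_⟩
  · exact Ideal.finiteQuotientOfFreeOfNeBot _ (by simpa [Ideal.span_singleton_eq_bot] using hc0)
  · intro m m' h
    rw [Ideal.Quotient.eq, Ideal.mem_span_singleton'] at h
    obtain ⟨a, ha⟩ := h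
    have h1 : (FinitePlace.mk v).1 ((r m : K) - r m') < ε := by
      have : (r m : K) - r m' = (a : K) * c := by exact_mod_cast ha.symm
      rw [this, map_mul]
      refine lt_of_le_of_lt ?_ hcε
      exact mul_le_of_le_one_left (AbsoluteValue.nonneg _ _) (hint a)
    have hadd := fun y z => FinitePlace.add_le (FinitePlace.mk v) y z
    have h2 : x ^ m - x ^ m' = -((r m : K) - x ^ m) + ((r m - r m') + ((r m' : K) - x ^ m')) := by
      ring
    rw [h2]
    refine lt_of_le_of_lt (hadd _ _) (max_lt ?_ (lt_of_le_of_lt (hadd _ _) (max_lt h1 (hr m'))))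
    have := hr m
    rw [← map_neg_eq_map] at this
    exact this

lemma hasFiniteColorings_of_ringHom {K : Type*} [Field K] (φ : K →+* ℂ)
    (v : AbsoluteValue K ℝ) (hv : ∀ y, v y = ‖φ y‖) (x : K) (hx : v x = 1) :
    HasFiniteColorings v x := by
  refine .of_finite fun ε hε => ?_
  have htb : TotallyBounded (Metric.closedBall (0 : ℂ) 1) :=
    (isCompact_closedBall (0 : ℂ) 1).totallyBounded
  obtain ⟨t, ht, hcov⟩ := Metric.totallyBounded_iff.1 htb (ε / 2) (half_pos hε)
  have hmem : ∀ m : ℕ, ∃ y : t, dist (φ x ^ m) y < ε / 2 := by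
    intro m
    have : φ x ^ m ∈ Metric.closedBall (0 : ℂ) 1 := by
      simp [← hv, hx]
    simpa using hcov this
  choose c hc using hmem
  refine ⟨t, ht.to_subtype, c, fun m m' h => ?_⟩
  rw [hv, map_sub, map_pow, map_pow, ← dist_eq_norm]
  have h1 := hc m
  have h2 := hc m'
  rw [h] at h1
  linarith [dist_triangle_right (φ x ^ m) (φ x ^ m') (c m')]

lemma exists_common_recurrence {K ι : Type*} [Field K] [Finite ι] (v : ι → AbsoluteValue K ℝ)
    (x : K) (h : ∀ i, v i x = 1 → HasFiniteColorings (v i) x) :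
    ∃ a : ℕ → ℕ, Tendsto a atTop atTop ∧
      ∀ i, v i x = 1 → Tendsto (fun j => v i (x ^ a j - 1)) atTop (𝓝 0) := by
  have key : ∀ j : ℕ, ∃ m ≥ j, ∀ i, v i x = 1 → v i (x ^ m - 1) < 1 / ((j : ℝ) + 1) := by
    intro j
    have hε : (0 : ℝ) < 1 / ((j : ℝ) + 1) := by positivity
    have h' : ∀ i : {i // v i x = 1}, ∃ (N : ℕ) (c : ℕ → Fin N),
        ∀ m m' : ℕ, c m = c m' → v i (x ^ m - x ^ m') < 1 / ((j : ℝ) + 1) :=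
      fun i => h i i.2 _ hε
    choose C c hc using h'
    obtain ⟨y, hy⟩ := Finite.exists_infinite_fiber (fun m : ℕ => fun i => c i m)
    rw [Set.infinite_coe_iff] at hy
    obtain ⟨m₁, hm₁⟩ := hy.nonempty
    obtain ⟨m₂, hm₂, hlt⟩ := hy.exists_gt (m₁ + j)
    refine ⟨m₂ - m₁, by omega, fun i hi => ?_⟩
    have hcol : c ⟨i, hi⟩ m₂ = c ⟨i, hi⟩ m₁ := by
      have e1 : (fun i => c i m₁) = y := hm₁
      have e2 : (fun i => c i m₂) = y := hm₂
      exact congrFun (e2.trans e1.symm) ⟨i, hi⟩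
    have := hc ⟨i, hi⟩ _ _ hcol
    have e : x ^ m₂ - x ^ m₁ = x ^ m₁ * (x ^ (m₂ - m₁) - 1) := by
      rw [mul_sub, ← pow_add, Nat.add_sub_of_le (by omega), mul_one]
    rwa [e, map_mul, map_pow, hi, one_pow, one_mul] at this
  choose a ha hav using key
  refine ⟨a, tendsto_atTop_mono ha tendsto_id, fun i hi => ?_⟩
  exact squeeze_zero (fun _ => AbsoluteValue.nonneg _ _) (fun j => (hav j i hi).le)
    tendsto_one_div_add_atTop_nhds_zero_nat

lemma tendsto_eval_mul_eval_inv {F : Type*} [NormedField F] (p : F[X]) (hp : 0 < p.degree)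
    (hp0 : ‖p.eval 0‖ = 1) (x : F) (hx0 : x ≠ 0) (hx : ‖x‖ < 1) (a : ℕ → ℕ)
    (ha : Tendsto a atTop atTop) :
    Tendsto (fun j => ‖p.eval (x ^ a j) * p.eval ((x ^ a j)⁻¹)‖) atTop atTop := by
  have h1 : Tendsto (fun j => x ^ a j) atTop (𝓝 0) :=
    (tendsto_pow_atTop_nhds_zero_of_norm_lt_one hx).comp ha
  have h2 : Tendsto (fun j => ‖p.eval (x ^ a j)‖) atTop (𝓝 1) := by
    rw [← hp0]
    exact ((p.continuous.tendsto 0).comp h1).norm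
  have h3 : Tendsto (fun j => ‖p.eval ((x ^ a j)⁻¹)‖) atTop atTop := by
    refine Polynomial.tendsto_norm_atTop p hp ?_
    have : Tendsto (fun j => ‖x⁻¹‖ ^ a j) atTop atTop :=
      (tendsto_pow_atTop_atTop_of_one_lt (by
        rw [norm_inv]; exact (one_lt_inv₀ (norm_pos_iff.2 hx0)).2 hx)).comp ha
    simpa [norm_inv, norm_pow, inv_pow] using this
  simp only [norm_mul]
  exact h2.pos_mul_atTop one_pos h3

lemma local_lower_bound {F : Type*} [NormedField F] (p : F[X]) (hp : 0 < p.degree)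
    (hp0 : ‖p.eval 0‖ = 1) (x : F) (hx0 : x ≠ 0) (hpx : p.eval x ≠ 0) (hpx' : p.eval x⁻¹ ≠ 0)
    (a : ℕ → ℕ) (ha : Tendsto a atTop atTop)
    (hrec : ‖x‖ = 1 → Tendsto (fun j => ‖x ^ a j - 1‖) atTop (𝓝 0)) :
    (∃ δ > 0, ∀ᶠ j in atTop, δ ≤ ‖p.eval (x ^ (a j + 1)) * p.eval ((x ^ (a j + 1))⁻¹)‖) ∧
    (‖x‖ ≠ 1 → Tendsto (fun j => ‖p.eval (x ^ (a j + 1)) * p.eval ((x ^ (a j + 1))⁻¹)‖)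
      atTop atTop) := by
  have ha' : Tendsto (fun j => a j + 1) atTop atTop := (tendsto_add_atTop_nat 1).comp ha
  have hne : ‖x‖ ≠ 1 → Tendsto
      (fun j => ‖p.eval (x ^ (a j + 1)) * p.eval ((x ^ (a j + 1))⁻¹)‖) atTop atTop := by
    intro h
    rcases lt_or_gt_of_ne h with h | h
    · exact tendsto_eval_mul_eval_inv p hp hp0 x hx0 h _ ha'
    · have := tendsto_eval_mul_eval_inv p hp hp0 x⁻¹ (inv_ne_zero hx0)
        (by rw [norm_inv]; exact inv_lt_one_of_one_lt₀ h) _ ha'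
      refine this.congr fun j => ?_
      rw [inv_pow, inv_inv, mul_comm]
  refine ⟨?_, hne⟩
  by_cases h : ‖x‖ = 1
  · have h1 : Tendsto (fun j => x ^ a j) atTop (𝓝 1) := tendsto_iff_norm_sub_tendsto_zero.2 (hrec h)
    have h2 : Tendsto (fun j => x ^ (a j + 1)) atTop (𝓝 x) := by
      simpa [pow_succ] using h1.mul_const x
    have h3 : Tendsto (fun j => (x ^ (a j + 1))⁻¹) atTop (𝓝 x⁻¹) := h2.inv₀ hx0
    have h4 : Tendsto (fun j => ‖p.eval (x ^ (a j + 1)) * p.eval ((x ^ (a j + 1))⁻¹)‖) atTop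
        (𝓝 ‖p.eval x * p.eval x⁻¹‖) :=
      (((p.continuous.tendsto _).comp h2).mul ((p.continuous.tendsto _).comp h3)).norm
    have hpos : 0 < ‖p.eval x * p.eval x⁻¹‖ := norm_pos_iff.2 (mul_ne_zero hpx hpx')
    exact ⟨_, half_pos hpos, h4.eventually (eventually_ge_nhds (half_lt_self hpos))⟩
  · exact ⟨1, one_pos, (hne h).eventually_ge_atTop 1⟩

lemma AbsoluteValue.local_lower_bound {K : Type*} [Field K] (v : AbsoluteValue K ℝ) (n : ℕ)
    (hn : 1 < n) (x : K) (hx0 : x ≠ 0) (hpx : (cyclotomic n K).eval x ≠ 0)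
    (hpx' : (cyclotomic n K).eval x⁻¹ ≠ 0)
    (a : ℕ → ℕ) (ha : Tendsto a atTop atTop)
    (hrec : v x = 1 → Tendsto (fun j => v (x ^ a j - 1)) atTop (𝓝 0)) :
    (∃ δ > 0, ∀ᶠ j in atTop, δ ≤ v ((cyclotomic n K).eval (x ^ (a j + 1)) *
      (cyclotomic n K).eval ((x ^ (a j + 1))⁻¹))) ∧
    (v x ≠ 1 → Tendsto (fun j => v ((cyclotomic n K).eval (x ^ (a j + 1)) *
      (cyclotomic n K).eval ((x ^ (a j + 1))⁻¹))) atTop atTop) := by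
  let _ : NormedField K := v.toNormedField
  exact _root_.local_lower_bound (cyclotomic n K) (degree_cyclotomic_pos n K (by omega))
    (by rw [← coeff_zero_eq_eval_zero, cyclotomic_coeff_zero K hn]; exact map_one v)
    x hx0 hpx hpx' a ha hrec

lemma eval_cyclotomic_ne_zero {K : Type*} [Field K] [CharZero K] (φ : K →+* ℂ) {x : K}
    (hx : ‖φ x‖ ≠ 1) {n : ℕ} (hn : 1 < n) : (cyclotomic n K).eval x ≠ 0 := by
  intro h
  have := (isRoot_cyclotomic_iff_charZero (by omega)).1 h
  have h1 : ‖φ x‖ ^ n = 1 := by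
    rw [← norm_pow, ← map_pow, this.pow_eq_one, map_one, norm_one]
  exact hx ((pow_eq_one_iff_of_nonneg (norm_nonneg _) (by omega)).1 h1)

lemma prod_le_finprod_of_one_le {α : Type*} (f : α → ℝ) (hf : f.HasFiniteMulSupport)
    (T : Finset α) (h0 : ∀ a, 0 ≤ f a) (h : ∀ a ∉ T, 1 ≤ f a) : ∏ a ∈ T, f a ≤ ∏ᶠ a, f a := by
  classical
  rw [finprod_eq_prod_of_mulSupport_subset (s := T ∪ Set.Finite.toFinset hf) f
      (fun a ha => Finset.mem_union_right _ ((Set.Finite.mem_toFinset hf).2 ha)),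
    ← Finset.prod_sdiff (Finset.subset_union_left (s₁ := T))]
  refine le_mul_of_one_le_left (Finset.prod_nonneg fun a _ => h0 a) ?_
  refine Finset.prod_induction _ (1 ≤ ·) (fun a b ha hb => one_le_mul_of_one_le_of_one_le ha hb)
    le_rfl fun a ha => h a (Finset.mem_sdiff.1 ha).2

/-- Values of a cyclotomic polynomial at the powers of an element which is not of absolute value
one in some embedding cannot all be units outside of a finite set of places. -/
theorem exists_finitePlace_eval_cyclotomic_lt_one {K : Type*} [Field K] [NumberField K]
    (φ : K →+* ℂ) {x : K} (hx0 : x ≠ 0) (hx : ‖φ x‖ ≠ 1) (S : Set K) (hS : S.Finite) {n : ℕ}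
    (hn : 1 < n) :
    ∃ m : ℕ, ∃ w : FinitePlace K, 0 < m ∧ (∀ s ∈ S, w s ≤ 1) ∧
      w ((cyclotomic n K).eval (x ^ m) * (cyclotomic n K).eval ((x ^ m)⁻¹)) < 1 := by
  classical
  set D : ℕ → K := fun m => (cyclotomic n K).eval (x ^ m) * (cyclotomic n K).eval ((x ^ m)⁻¹)
    with hD
  by_contra! hcon
  have hbad : {w : FinitePlace K | ∃ s ∈ S, 1 < w s}.Finite := by
    have : {w : FinitePlace K | ∃ s ∈ S, 1 < w s} ⊆
        ⋃ s ∈ S, {w : FinitePlace K | 1 < w s} := by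
      rintro w ⟨s, hs, hw⟩
      exact Set.mem_biUnion hs hw
    refine (hS.biUnion fun s _ => ?_).subset this
    by_cases hs0 : s = 0
    · convert Set.finite_empty
      ext w
      simp [hs0, not_lt.2 zero_le_one]
    · exact Set.Finite.subset (FinitePlace.hasFiniteMulSupport hs0) fun w hw => (ne_of_gt hw)
  set T := hbad.toFinset with hT
  let v : T ⊕ InfinitePlace K → AbsoluteValue K ℝ := Sum.elim (fun w => w.1.1) (fun w => w.1)
  obtain ⟨a, ha, hrec⟩ := exists_common_recurrence v x (by
    rintro (w | w) hw
    · exact hasFiniteColorings_finitePlace w.1 x hw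
    · exact hasFiniteColorings_of_ringHom w.embedding _
        (fun y => (InfinitePlace.norm_embedding_eq w y).symm) x hw)
  have hxinv : ‖φ x⁻¹‖ ≠ 1 := by
    rw [map_inv₀, norm_inv]; simpa using hx
  have hloc := fun i => (v i).local_lower_bound n hn x hx0 (eval_cyclotomic_ne_zero φ hx hn)
    (eval_cyclotomic_ne_zero φ hxinv hn) a ha (hrec i)
  choose δ hδ hδev using fun i => (hloc i).1
  let mlt : T ⊕ InfinitePlace K → ℕ := Sum.elim (fun _ => 1) (fun w => w.mult)
  have hpow : ∀ m : ℕ, 0 < m → ‖φ (x ^ m)‖ ≠ 1 := by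
    intro m hm h
    rw [map_pow, norm_pow] at h
    exact hx ((pow_eq_one_iff_of_nonneg (norm_nonneg _) hm.ne').1 h)
  have hprod : ∀ m : ℕ, 0 < m → ∏ i, v i (D m) ^ mlt i ≤ 1 := by
    intro m hm
    have hne : D m ≠ 0 := by
      refine mul_ne_zero (eval_cyclotomic_ne_zero φ (hpow m hm) hn)
        (eval_cyclotomic_ne_zero φ ?_ hn)
      rw [map_inv₀, norm_inv]; simpa using hpow m hm
    rw [← prod_abs_eq_one hne, Fintype.prod_sum_type, mul_comm]
    refine mul_le_mul_of_nonneg_left ?_ (Finset.prod_nonneg fun w _ => pow_nonneg (apply_nonneg _ _) _)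
    refine le_trans (le_of_eq ?_) (prod_le_finprod_of_one_le (fun w : FinitePlace K => w (D m))
      (FinitePlace.hasFiniteMulSupport hne) T (fun w => apply_nonneg _ _) ?_)
    · rw [← Finset.prod_coe_sort T]
      exact Finset.prod_congr rfl fun w _ => pow_one _
    · intro w hw
      refine hcon m w hm fun s hs => ?_
      by_contra! h
      exact hw (hbad.mem_toFinset.2 ⟨s, hs, h⟩)
  set i₀ : T ⊕ InfinitePlace K := Sum.inr (InfinitePlace.mk φ) with hi₀
  have hlim : Tendsto (fun j => v i₀ (D (a j + 1)) ^ mlt i₀ *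
      ∏ i ∈ Finset.univ.erase i₀, δ i ^ mlt i) atTop atTop := by
    refine Tendsto.atTop_mul_const (Finset.prod_pos fun i _ => pow_pos (hδ i) _) ?_
    refine (tendsto_pow_atTop (InfinitePlace.mult_pos).ne').comp ((hloc i₀).2 ?_)
    exact hx
  obtain ⟨j, hj1, hj2⟩ := ((hlim.eventually_gt_atTop 1).and (eventually_all.2 hδev)).exists
  refine absurd (hprod (a j + 1) (Nat.succ_pos _)) (not_le.2 (hj1.trans_le ?_))
  rw [← Finset.mul_prod_erase _ _ (Finset.mem_univ i₀)]
  refine mul_le_mul_of_nonneg_left ?_ (pow_nonneg (AbsoluteValue.nonneg _ _) _)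
  exact Finset.prod_le_prod (fun i _ => (pow_pos (hδ i) _).le) fun i _ =>
    pow_le_pow_left₀ (hδ i).le (hj2 i) _

lemma eq_or_eq_neg_of_mem_center {A : Type*} [CommRing A] [IsDomain A]
    {M : Matrix.SpecialLinearGroup (Fin 2) A} (h : M ∈ Subgroup.center (Matrix.SpecialLinearGroup (Fin 2) A)) :
    M = 1 ∨ M = -1 := by
  obtain ⟨r, hr, hM⟩ := Matrix.SpecialLinearGroup.mem_center_iff.1 h
  rw [Fintype.card_fin, sq_eq_one_iff] at hr
  refine hr.imp (fun h => ?_) (fun h => ?_) <;> ext i j <;>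
    fin_cases i <;> fin_cases j <;> simp [← hM, h]

lemma mk_eq_mk_iff {A B : SL2C} : (QuotientGroup.mk A : PSL2C) = QuotientGroup.mk B ↔
    A = B ∨ A = -B := by
  rw [QuotientGroup.eq]
  constructor
  · intro h
    rcases eq_or_eq_neg_of_mem_center h with h | h
    · left; exact inv_mul_eq_one.1 h
    · right
      rw [inv_mul_eq_iff_eq_mul] at h
      rw [h]; simp
  · rintro (rfl | rfl)
    · simp
    · rw [Matrix.SpecialLinearGroup.mem_center_iff]
      refine ⟨-1, by simp, ?_⟩
      have : (-B)⁻¹ * B = -1 := by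
        rw [inv_mul_eq_iff_eq_mul]; simp
      rw [this]
      ext i j
      fin_cases i <;> fin_cases j <;> simp

/-- The one-parameter family of diagonal matrices in `SL(2, ℂ)`. -/
noncomputable def diagSL : ℂˣ →* SL2C where
  toFun r := ⟨!![(r : ℂ), 0; 0, ((r⁻¹ : ℂˣ) : ℂ)], by simp [det_fin_two]⟩
  map_one' := by
    ext i j; fin_cases i <;> fin_cases j <;> simp
  map_mul' r s := by
    apply Subtype.ext
    change !![((r * s : ℂˣ) : ℂ), 0; 0, (((r * s)⁻¹ : ℂˣ) : ℂ)] =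
      !![(r : ℂ), 0; 0, ((r⁻¹ : ℂˣ) : ℂ)] * !![(s : ℂ), 0; 0, ((s⁻¹ : ℂˣ) : ℂ)]
    ext i j; fin_cases i <;> fin_cases j <;> simp [mul_comm]

lemma coe_diagSL (r : ℂˣ) : (diagSL r : Matrix (Fin 2) (Fin 2) ℂ) =
    !![(r : ℂ), 0; 0, ((r⁻¹ : ℂˣ) : ℂ)] := rfl

lemma norm_ne_one_of_loxodromic {l t : ℂ} (ht : l + l⁻¹ = t)
    (h : ∀ r : ℝ, 0 ≤ r → r ≤ 4 → t ^ 2 ≠ (r : ℂ)) : ‖l‖ ≠ 1 := by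
  intro hl
  have hinv : l⁻¹ = (starRingEnd ℂ) l := by
    rw [Complex.inv_def, Complex.normSq_eq_norm_sq, hl]; simp
  rw [hinv, Complex.add_conj] at ht
  have hre : |l.re| ≤ 1 := hl ▸ Complex.abs_re_le_norm l
  refine h ((2 * l.re) ^ 2) (sq_nonneg _) ?_ ?_
  · nlinarith [abs_le.1 hre, sq_abs l.re, abs_nonneg l.re]
  · rw [← ht]; push_cast; ring

lemma exists_diagonalization (X : SL2C)
    (h : ∀ r : ℝ, 0 ≤ r → r ≤ 4 → (Matrix.trace (X : Matrix (Fin 2) (Fin 2) ℂ)) ^ 2 ≠ (r : ℂ)) :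
    ∃ (P : SL2C) (μ : ℂˣ), ‖(μ : ℂ)‖ ≠ 1 ∧ X = P * diagSL μ * P⁻¹ := by
  obtain ⟨a, b, c, d, hdet, hX⟩ : ∃ (a b c d : ℂ) (_ : a * d - b * c = 1),
      (X : Matrix (Fin 2) (Fin 2) ℂ) = !![a, b; c, d] := by
    refine ⟨X 0 0, X 0 1, X 1 0, X 1 1, ?_, ?_⟩
    · rw [← det_fin_two, X.det_coe]
    · ext i j; fin_cases i <;> fin_cases j <;> rfl
  simp only [hX, trace_fin_two_of] at h
  obtain ⟨l, hl⟩ : ∃ l : ℂ, l ^ 2 - (a + d) * l + 1 = 0 := by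
    obtain ⟨l, hl⟩ := IsAlgClosed.exists_root
      (C (1 : ℂ) * Polynomial.X ^ 2 + C (-(a + d)) * Polynomial.X + C 1)
      (by rw [degree_quadratic one_ne_zero]; norm_num)
    refine ⟨l, ?_⟩
    simp [IsRoot] at hl
    linear_combination hl
  have hl0 : l ≠ 0 := by rintro rfl; simp at hl
  have ht : l + l⁻¹ = a + d := by field_simp; linear_combination hl
  have hn := norm_ne_one_of_loxodromic ht h
  have hne : l - l⁻¹ ≠ 0 := by
    intro h0
    have h1 : l ^ 2 = 1 := by field_simp at h0; linear_combination h0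
    apply hn
    have : ‖l‖ ^ 2 = 1 := by rw [← norm_pow, h1, norm_one]
    exact (pow_eq_one_iff_of_nonneg (norm_nonneg _) two_ne_zero).1 this
  suffices hs : ∃ (p q r s : ℂ) (hP : p * s - q * r = 1) (m : ℂ) (hm : m ≠ 0), ‖m‖ ≠ 1 ∧
      !![a, b; c, d] * !![p, q; r, s] = !![p, q; r, s] * !![m, 0; 0, m⁻¹] by
    obtain ⟨p, q, r, s, hP, m, hm, hnm, hmul⟩ := hs
    obtain ⟨P, hPm⟩ : ∃ P : SL2C, (P : Matrix (Fin 2) (Fin 2) ℂ) = !![p, q; r, s] :=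
      ⟨⟨!![p, q; r, s], by rw [det_fin_two_of]; exact hP⟩, rfl⟩
    refine ⟨P, Units.mk0 m hm, hnm, ?_⟩
    rw [eq_mul_inv_iff_mul_eq]
    apply Subtype.ext
    rw [Matrix.SpecialLinearGroup.coe_mul, Matrix.SpecialLinearGroup.coe_mul, hX, hPm, coe_diagSL,
      hmul]
    simp
  by_cases hc : c = 0
  · subst hc
    have had : a * d = 1 := by linear_combination hdet
    have ha0 : a ≠ 0 := left_ne_zero_of_mul_eq_one had
    have hd : d = a⁻¹ := eq_inv_of_mul_eq_one_right had
    subst hd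
    have hn' := norm_ne_one_of_loxodromic rfl h
    have hne' : a⁻¹ - a ≠ 0 := by
      intro h0
      have h1 : a ^ 2 = 1 := by field_simp at h0; linear_combination -h0
      apply hn'
      have : ‖a‖ ^ 2 = 1 := by rw [← norm_pow, h1, norm_one]
      exact (pow_eq_one_iff_of_nonneg (norm_nonneg _) two_ne_zero).1 this
    refine ⟨1, b / (a⁻¹ - a), 0, 1, by ring, a, ha0, hn', ?_⟩
    ext i j; fin_cases i <;> fin_cases j <;> simp [Matrix.mul_apply, Fin.sum_univ_two]
    generalize a⁻¹ = e at *
    field_simp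
    ring
  · refine ⟨(l - d) / (c * (l - l⁻¹)), l⁻¹ - d, c / (c * (l - l⁻¹)), c, ?_, l, hl0, hn, ?_⟩
    · generalize l⁻¹ = e at *
      field_simp
      ring
    · have e1 : a * (l - d) + b * c = l * (l - d) := by linear_combination -hl - hdet
      have e2 : a * (l⁻¹ - d) + b * c = l⁻¹ * (l⁻¹ - d) := by
        have : l⁻¹ ^ 2 - (a + d) * l⁻¹ + 1 = 0 := by
          field_simp; linear_combination hl
        linear_combination -this - hdet
      ext i j; fin_cases i <;> fin_cases j <;> simp [Matrix.mul_apply, Fin.sum_univ_two]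
      · generalize l⁻¹ = e at *
        field_simp
        linear_combination e1
      · linear_combination e2
      · generalize l⁻¹ = e at *
        field_simp
        ring
      · ring

lemma sq_ne_of_norm_ne_one {μ : ℂ} (hμ : ‖μ‖ ≠ 1) {u : ℂ} (hu : ‖u‖ = 1) : μ ^ 2 ≠ u := by
  intro h
  have : ‖μ‖ ^ 2 = 1 := by rw [← norm_pow, h, hu]
  exact hμ ((pow_eq_one_iff_of_nonneg (norm_nonneg _) two_ne_zero).1 this)

lemma eq_diagSL_of_commute {μ : ℂˣ} (hμ : ‖(μ : ℂ)‖ ≠ 1) {C : SL2C}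
    (h : C * diagSL μ = diagSL μ * C ∨ C * diagSL μ = -(diagSL μ * C)) :
    ∃ ν : ℂˣ, C = diagSL ν := by
  have hμ1 := sq_ne_of_norm_ne_one hμ (u := 1) (by simp)
  have hμ2 := sq_ne_of_norm_ne_one hμ (u := -1) (by simp)
  have hμ0 : (μ : ℂ) ≠ 0 := μ.ne_zero
  have hdet : C 0 0 * C 1 1 - C 0 1 * C 1 0 = 1 := by rw [← det_fin_two, C.det_coe]
  rcases h with h | h <;> replace h := congrArg Subtype.val h <;>
    simp only [Matrix.SpecialLinearGroup.coe_mul, Matrix.SpecialLinearGroup.coe_neg] at h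
  · have h01 := congrFun (congrFun h 0) 1
    have h10 := congrFun (congrFun h 1) 0
    simp [coe_diagSL, Matrix.mul_apply, Fin.sum_univ_two] at h01 h10
    field_simp at h01 h10
    have hb : C 0 1 = 0 := by
      by_contra hb
      exact hμ1 (mul_left_cancel₀ hb (by linear_combination -h01))
    have hc : C 1 0 = 0 := by
      by_contra hc
      exact hμ1 (mul_left_cancel₀ hc (by linear_combination h10))
    have had : C 0 0 * C 1 1 = 1 := by linear_combination hdet + C 1 0 * hb
    refine ⟨⟨C 0 0, C 1 1, had, by rw [mul_comm]; exact had⟩, ?_⟩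
    ext i j; fin_cases i <;> fin_cases j <;> simp [coe_diagSL, hb, hc]
  · exfalso
    have h00 := congrFun (congrFun h 0) 0
    have h01 := congrFun (congrFun h 0) 1
    simp [coe_diagSL, Matrix.mul_apply, Matrix.vecMul, dotProduct, Fin.sum_univ_two] at h00 h01
    field_simp at h00 h01
    have hb : C 0 1 = 0 := by
      by_contra hb
      exact hμ2 (mul_left_cancel₀ hb (by linear_combination h01))
    have ha : C 0 0 = 0 := by linear_combination h00 / 2
    rw [ha, hb] at hdet
    simp at hdet

/-- The torus in `PSL(2, ℂ)` obtained by conjugating the diagonal one. -/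
noncomputable def torus (P : SL2C) : ℂˣ →* PSL2C :=
  (QuotientGroup.mk' _).comp ((MulAut.conj P).toMonoidHom.comp diagSL)

lemma torus_apply (P : SL2C) (r : ℂˣ) : torus P r = QuotientGroup.mk (P * diagSL r * P⁻¹) := rfl

lemma continuous_torus (P : SL2C) : Continuous (torus P) := by
  refine continuous_quotient_mk'.comp (continuous_induced_rng.2 ?_)
  change Continuous fun r : ℂˣ => (P : Matrix (Fin 2) (Fin 2) ℂ) *
    (diagSL r : Matrix (Fin 2) (Fin 2) ℂ) * ((P⁻¹ : SL2C) : Matrix (Fin 2) (Fin 2) ℂ)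
  refine (continuous_const.matrix_mul ?_).matrix_mul continuous_const
  refine continuous_matrix fun i j => ?_
  have h1 : Continuous fun r : ℂˣ => (r : ℂ) := Units.continuous_val
  have h2 : Continuous fun r : ℂˣ => ((r⁻¹ : ℂˣ) : ℂ) := Units.continuous_coe_inv
  fin_cases i <;> fin_cases j
  · exact h1
  · exact continuous_const
  · exact continuous_const
  · exact h2

lemma IsLoxodromic.exists_torus {x : PSL2C} (hx : IsLoxodromic x) :
    ∃ (P : SL2C) (μ : ℂˣ), ‖(μ : ℂ)‖ ≠ 1 ∧ x = torus P μ ∧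
      ∀ g : PSL2C, g * x = x * g → ∃ ν : ℂˣ, g = torus P ν := by
  obtain ⟨X, rfl, hX⟩ := hx
  obtain ⟨P, μ, hμ, rfl⟩ := exists_diagonalization X hX
  refine ⟨P, μ, hμ, rfl, fun g hg => ?_⟩
  obtain ⟨C, rfl⟩ := QuotientGroup.mk_surjective g
  rw [← QuotientGroup.mk_mul, ← QuotientGroup.mk_mul, mk_eq_mk_iff] at hg
  obtain ⟨ν, hν⟩ := eq_diagSL_of_commute hμ (C := P⁻¹ * C * P) (by
    refine hg.imp (fun h => ?_) (fun h => ?_)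
    · calc P⁻¹ * C * P * diagSL μ = P⁻¹ * (C * (P * diagSL μ * P⁻¹)) * P := by group
        _ = _ := by rw [h]; group
    · calc P⁻¹ * C * P * diagSL μ = P⁻¹ * (C * (P * diagSL μ * P⁻¹)) * P := by group
        _ = -(P⁻¹ * (P * diagSL μ * P⁻¹ * C) * P) := by rw [h, mul_neg, neg_mul]
        _ = _ := by congr 1; group)
  refine ⟨ν, ?_⟩
  rw [torus_apply, ← hν]
  congr 1
  group

lemma exists_pow_eq_zpow_of_discrete (Γ : Subgroup PSL2C) (hdisc : DiscreteTopology ↥Γ)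
    (P : SL2C) {μ ν : ℂˣ} (hμ : ‖(μ : ℂ)‖ ≠ 1) {x g : Γ} (hx : (x : PSL2C) = torus P μ)
    (hg : (g : PSL2C) = torus P ν) : ∃ a : ℕ, 0 < a ∧ ∃ b : ℤ, g ^ a = x ^ b := by
  have hμ0 : 0 < ‖(μ : ℂ)‖ := norm_pos_iff.2 μ.ne_zero
  have hν0 : 0 < ‖(ν : ℂ)‖ := norm_pos_iff.2 ν.ne_zero
  set L := Real.log ‖(μ : ℂ)‖ with hL
  have hL0 : L ≠ 0 := Real.log_ne_zero_of_pos_of_ne_one hμ0 hμ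
  set i : ℕ → ℤ := fun j => ⌊j * Real.log ‖(ν : ℂ)‖ / L⌋ with hi
  set c : ℕ → ℂˣ := fun j => ν ^ j * μ ^ (-i j) with hc
  have hlog : ∀ j, Real.log ‖(c j : ℂ)‖ = L * Int.fract (j * Real.log ‖(ν : ℂ)‖ / L) := by
    intro j
    simp only [hc, Units.val_mul, Units.val_pow_eq_pow_val, Units.val_zpow_eq_zpow_val, norm_mul,
      norm_pow, norm_zpow]
    rw [Real.log_mul (by positivity) (by positivity), Real.log_pow, Real.log_zpow, Int.fract,
      ← hL]
    simp only [hi]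
    push_cast
    field_simp
    ring
  have hbd : ∀ j, |Real.log ‖(c j : ℂ)‖| ≤ |L| := by
    intro j
    rw [hlog, abs_mul]
    refine mul_le_of_le_one_right (abs_nonneg _) ?_
    rw [abs_of_nonneg (Int.fract_nonneg _)]
    exact (Int.fract_lt_one _).le
  have hcpt : IsCompact (Metric.closedBall (0 : ℂ) (Real.exp |L|) ∩
      {z | Real.exp (-|L|) ≤ ‖z‖}) :=
    (isCompact_closedBall _ _).inter_right (isClosed_le continuous_const continuous_norm)
  have hmem : ∀ j, (c j : ℂ) ∈ Metric.closedBall (0 : ℂ) (Real.exp |L|) ∩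
      {z | Real.exp (-|L|) ≤ ‖z‖} := by
    intro j
    have hp : 0 < ‖(c j : ℂ)‖ := norm_pos_iff.2 (c j).ne_zero
    have := abs_le.1 (hbd j)
    refine ⟨?_, ?_⟩
    · rw [mem_closedBall_zero_iff]
      exact (Real.log_le_iff_le_exp hp).1 this.2
    · exact (Real.le_log_iff_exp_le hp).1 this.1
  obtain ⟨z, hz, s, hs, hlim⟩ := hcpt.tendsto_subseq hmem
  have hz0 : z ≠ 0 := norm_pos_iff.1 ((Real.exp_pos _).trans_le hz.2)
  have hratio : Tendsto (fun k => c (s (k + 1)) * (c (s k))⁻¹) atTop (𝓝 1) := by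
    rw [Units.isEmbedding_val₀.tendsto_nhds_iff]
    have := (hlim.comp (tendsto_add_atTop_nat 1)).mul (hlim.inv₀ hz0)
    rw [mul_inv_cancel₀ hz0] at this
    refine this.congr fun k => ?_
    simp
  have hT : Tendsto (fun k => torus P (c (s (k + 1)) * (c (s k))⁻¹)) atTop (𝓝 1) := by
    have := ((continuous_torus P).tendsto 1).comp hratio
    rwa [map_one] at this
  have hval : ∀ j, torus P (c j) = ((g ^ j * x ^ (-i j) : Γ) : PSL2C) := by
    intro j
    simp [hc, hx, hg]
  set y : ℕ → Γ := fun k => (g ^ (s (k + 1)) * x ^ (-i (s (k + 1)))) *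
    (g ^ (s k) * x ^ (-i (s k)))⁻¹ with hy
  have hyT : Tendsto y atTop (𝓝 1) := by
    rw [tendsto_subtype_rng]
    refine hT.congr fun k => ?_
    rw [map_mul, map_inv, hval, hval]
    rfl
  rw [nhds_discrete, tendsto_pure] at hyT
  obtain ⟨k, hk⟩ := hyT.exists
  have hlt : s k < s (k + 1) := hs (Nat.lt_succ_self k)
  refine ⟨s (k + 1) - s k, by omega, i (s (k + 1)) - i (s k), ?_⟩
  have h1 := mul_inv_eq_one.1 hk
  have h2 : g ^ s k * g ^ (s (k + 1) - s k) = g ^ s k * x ^ (i (s (k + 1)) - i (s k)) := by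
    rw [← pow_add, Nat.add_sub_of_le hlt.le, sub_eq_neg_add, _root_.zpow_add, ← mul_assoc, ← h1,
      mul_assoc, ← _root_.zpow_add, neg_add_cancel, zpow_zero, mul_one]
  exact mul_left_cancel h2

/-- Reduction modulo an ideal, from `SL(2, A)` to `PSL(2, A / I)`. -/
noncomputable def reductionHom {A : Type} [CommRing A] (I : Ideal A) :
    Matrix.SpecialLinearGroup (Fin 2) A →* PSL2 (A ⧸ I) :=
  (QuotientGroup.mk' _).comp (Matrix.SpecialLinearGroup.map (Ideal.Quotient.mk I))

lemma reductionHom_eq_one_iff {A : Type} [CommRing A] {I : Ideal A}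
    {M : Matrix.SpecialLinearGroup (Fin 2) A} : reductionHom I M = 1 ↔
      Matrix.SpecialLinearGroup.map (Ideal.Quotient.mk I) M ∈ Subgroup.center _ :=
  QuotientGroup.eq_one_iff _

lemma neg_one_mem_center {A : Type*} [CommRing A] :
    (-1 : Matrix.SpecialLinearGroup (Fin 2) A) ∈ Subgroup.center _ := by
  rw [Subgroup.mem_center_iff]
  intro g
  simp

lemma map_neg_one_specialLinearGroup {A B : Type*} [CommRing A] [CommRing B] (f : A →+* B) :
    Matrix.SpecialLinearGroup.map f (-1 : Matrix.SpecialLinearGroup (Fin 2) A) = -1 := by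
  ext i j
  fin_cases i <;> fin_cases j <;> simp

lemma reductionHom_neg {A : Type} [CommRing A] (I : Ideal A)
    (M : Matrix.SpecialLinearGroup (Fin 2) A) : reductionHom I (-M) = reductionHom I M := by
  have h : reductionHom I (-1 : Matrix.SpecialLinearGroup (Fin 2) A) = 1 := by
    rw [reductionHom_eq_one_iff, map_neg_one_specialLinearGroup]
    exact neg_one_mem_center
  rw [← neg_one_mul, map_mul, h, one_mul]

lemma map_subtype_injective (R : Subring ℂ) : Function.Injective
    (Matrix.SpecialLinearGroup.map (n := Fin 2) R.subtype) := by
  intro A B h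
  ext i j
  have := congrFun (congrFun (congrArg Subtype.val h) i) j
  simpa using this

lemma eq_or_eq_neg_of_mk_map_eq {R : Subring ℂ} {A B : Matrix.SpecialLinearGroup (Fin 2) R}
    (h : (QuotientGroup.mk (Matrix.SpecialLinearGroup.map R.subtype A) : PSL2C) =
      QuotientGroup.mk (Matrix.SpecialLinearGroup.map R.subtype B)) : A = B ∨ A = -B := by
  rw [mk_eq_mk_iff] at h
  refine h.imp (fun h => map_subtype_injective R h) (fun h => map_subtype_injective R ?_)
  rw [h]
  ext i j
  simp

lemma exists_congruenceHom {R : Subring ℂ} {Γ : Subgroup PSL2C} (hΓR : ContainedInPSL2 R Γ)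
    (I : Ideal R) : ∃ η : ↥Γ →* PSL2 (↥R ⧸ I),
      ∀ (x : ↥Γ) (A : Matrix.SpecialLinearGroup (Fin 2) ↥R),
        (QuotientGroup.mk (Matrix.SpecialLinearGroup.map R.subtype A) : PSL2C) = (x : PSL2C) →
        η x = reductionHom I A := by
  choose rep hrep using hΓR
  have key : ∀ (x : ↥Γ) (A : Matrix.SpecialLinearGroup (Fin 2) ↥R),
      (QuotientGroup.mk (Matrix.SpecialLinearGroup.map R.subtype A) : PSL2C) = (x : PSL2C) →
      reductionHom I (rep x) = reductionHom I A := by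
    intro x A hA
    rcases eq_or_eq_neg_of_mk_map_eq ((hrep x).trans hA.symm) with h | h
    · rw [h]
    · rw [h, reductionHom_neg]
  refine ⟨MonoidHom.mk' (fun x => reductionHom I (rep x)) fun x y => ?_, key⟩
  rw [← map_mul]
  refine key _ _ ?_
  rw [map_mul, QuotientGroup.mk_mul, hrep, hrep, Subgroup.coe_mul]

lemma eq_one_or_eq_neg_one_of_reductionHom_eq_one {A : Type} [CommRing A] [IsDomain A]
    [IsNoetherianRing A] {Q : Ideal A} (hQ : Q ≠ ⊤) {M : Matrix.SpecialLinearGroup (Fin 2) A}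
    (h : ∀ i, reductionHom (Q ^ (i + 1)) M = 1) : M = 1 ∨ M = -1 := by
  have hzero : ∀ a : A, (∀ i, a ∈ Q ^ (i + 1)) → a = 0 := by
    intro a ha
    rw [← Ideal.mem_bot, ← Ideal.iInf_pow_eq_bot_of_isDomain Q hQ, Ideal.mem_iInf]
    rintro (_ | i)
    · simp
    · exact ha i
  have hent : ∀ i, M 0 1 ∈ Q ^ (i + 1) ∧ M 1 0 ∈ Q ^ (i + 1) ∧ M 0 0 - M 1 1 ∈ Q ^ (i + 1) := by
    intro i
    obtain ⟨r, -, hr⟩ := Matrix.SpecialLinearGroup.mem_center_iff.1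
      (reductionHom_eq_one_iff.1 (h i))
    have e := fun k l => congrFun (congrFun hr k) l
    refine ⟨?_, ?_, ?_⟩
    · exact Ideal.Quotient.eq_zero_iff_mem.1 (by simpa using (e 0 1).symm)
    · exact Ideal.Quotient.eq_zero_iff_mem.1 (by simpa using (e 1 0).symm)
    · have e0 := e 0 0
      have e1 := e 1 1
      simp at e0 e1
      rw [← Ideal.Quotient.eq, ← e0, ← e1]
  have hb := hzero _ fun i => (hent i).1
  have hc := hzero _ fun i => (hent i).2.1
  have hd := hzero _ fun i => (hent i).2.2
  apply eq_or_eq_neg_of_mem_center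
  have hdet : M 0 0 * M 1 1 - M 0 1 * M 1 0 = 1 := by rw [← det_fin_two, M.det_coe]
  rw [Matrix.SpecialLinearGroup.mem_center_iff]
  refine ⟨M 0 0, ?_, ?_⟩
  · rw [Fintype.card_fin]
    linear_combination hdet + M 0 0 * hd + M 1 0 * hb
  · ext i j
    fin_cases i <;> fin_cases j <;> simp [hb, hc, sub_eq_zero.1 hd]

lemma pow_two_mul_eq_one_of_pow_mem_center {A : Type*} [CommRing A]
    {M : Matrix.SpecialLinearGroup (Fin 2) A} {t : ℕ} (h : M ^ t ∈ Subgroup.center _) :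
    M ^ (2 * t) = 1 := by
  obtain ⟨r, hr, hM⟩ := Matrix.SpecialLinearGroup.mem_center_iff.1 h
  rw [mul_comm, pow_mul]
  apply Subtype.ext
  rw [Matrix.SpecialLinearGroup.coe_pow, ← hM, ← map_pow]
  rw [Fintype.card_fin] at hr
  rw [hr, map_one]
  rfl

lemma map_mk_eq_one_iff {A : Type*} [CommRing A] {I : Ideal A}
    {M : Matrix.SpecialLinearGroup (Fin 2) A} :
    Matrix.SpecialLinearGroup.map (Ideal.Quotient.mk I) M = 1 ↔
      ∀ k l, ((M : Matrix (Fin 2) (Fin 2) A) - 1) k l ∈ I := by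
  rw [Matrix.SpecialLinearGroup.ext_iff]
  refine forall_congr' fun k => forall_congr' fun l => ?_
  rw [← Ideal.Quotient.eq_zero_iff_mem, Matrix.sub_apply, map_sub, sub_eq_zero]
  by_cases h : k = l
  · subst h; simp
  · simp [Matrix.one_apply_ne h]

/-- Raising to the `p`-th power a matrix congruent to one modulo a power of an ideal containing
`p` improves the congruence. -/
lemma map_pow_eq_one_of_map_eq_one {A : Type*} [CommRing A] {Q : Ideal A} {p i : ℕ}
    (hp : (p : A) ∈ Q) {M : Matrix.SpecialLinearGroup (Fin 2) A}
    (h : Matrix.SpecialLinearGroup.map (Ideal.Quotient.mk (Q ^ (i + 1))) M = 1) :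
    Matrix.SpecialLinearGroup.map (Ideal.Quotient.mk (Q ^ (i + 1 + 1))) (M ^ p) = 1 := by
  rw [map_mk_eq_one_iff] at h ⊢
  have hQ : Matrix.SpecialLinearGroup.map (Ideal.Quotient.mk Q) M = 1 :=
    map_mk_eq_one_iff.2 fun k l => Ideal.pow_le_self i.succ_ne_zero (h k l)
  have hQ' : (Ideal.Quotient.mk Q).mapMatrix (M : Matrix (Fin 2) (Fin 2) A) = 1 :=
    congrArg Subtype.val hQ
  have hsum : ∀ k l, (∑ j ∈ Finset.range p, (M : Matrix (Fin 2) (Fin 2) A) ^ j) k l ∈ Q := by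
    intro k l
    have h0 : (Ideal.Quotient.mk Q).mapMatrix
        (∑ j ∈ Finset.range p, (M : Matrix (Fin 2) (Fin 2) A) ^ j) = 0 := by
      have hp0 : (p : A ⧸ Q) = 0 := by
        rw [← map_natCast (Ideal.Quotient.mk Q), Ideal.Quotient.eq_zero_iff_mem.2 hp]
      rw [map_sum]
      simp only [map_pow, hQ', one_pow, Finset.sum_const, Finset.card_range, ← Nat.cast_smul_eq_nsmul
        (A ⧸ Q), hp0, zero_smul]
    exact Ideal.Quotient.eq_zero_iff_mem.1 (congrFun (congrFun h0 k) l)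
  intro k l
  rw [Matrix.SpecialLinearGroup.coe_pow, ← geom_sum_mul, Matrix.mul_apply, pow_succ' Q]
  exact Ideal.sum_mem _ fun j _ => Ideal.mul_mem_mul (hsum k j) (h j l)

lemma dvd_mul_pow_of_not_pow_dvd {p e d c i : ℕ} (hp : p.Prime) (hd : d ∣ c * p ^ i)
    (h : ¬ p ^ e ∣ d) : d ∣ c * p ^ e := by
  have hd0 : d ≠ 0 := by rintro rfl; exact h (dvd_zero _)
  obtain ⟨v, d', hd', rfl⟩ := Nat.exists_eq_pow_mul_and_not_dvd hd0 p hp.ne_one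
  have hv : v ≤ e := by
    by_contra! hv
    exact h (dvd_mul_of_dvd_left (pow_dvd_pow p hv.le) _)
  have hcop : Nat.Coprime d' (p ^ i) := ((hp.coprime_iff_not_dvd.2 hd').symm).pow_right i
  rw [mul_comm c]
  exact mul_dvd_mul (pow_dvd_pow p hv)
    (hcop.dvd_of_dvd_mul_right ((dvd_mul_left d' _).trans hd))

/-- If the prime `p` is not invertible then the order of an element of infinite order is
divisible by arbitrary powers of `p` modulo suitable ideals. -/
lemma exists_pow_dvd_orderOf_reductionHom_of_not_isUnit {A : Type} [CommRing A] [IsDomain A]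
    [IsNoetherianRing A] {p : ℕ} (hp : p.Prime) (hpu : ¬ IsUnit (p : A)) (hp0 : (p : A) ≠ 0)
    {M : Matrix.SpecialLinearGroup (Fin 2) A} (hM : ∀ n, 0 < n → M ^ n ≠ 1 ∧ M ^ n ≠ -1) (e : ℕ) :
    ∃ I : Ideal A, I ≠ ⊥ ∧ p ^ e ∣ orderOf (reductionHom I M) := by
  obtain ⟨Q, hQ, hpQ⟩ := exists_max_ideal_of_mem_nonunits hpu
  have hQ0 : Q ≠ ⊥ := by rintro rfl; exact hp0 (Ideal.mem_bot.1 hpQ)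
  by_contra! hcon
  replace hcon : ∀ i, ¬ p ^ e ∣ orderOf (reductionHom (Q ^ (i + 1)) M) :=
    fun i => hcon _ (pow_ne_zero _ hQ0)
  set t := orderOf (reductionHom (Q ^ (0 + 1)) M) with ht
  have ht0 : 0 < t := by
    rw [Nat.pos_iff_ne_zero]
    intro h
    exact hcon 0 (by rw [← ht, h]; exact dvd_zero _)
  have hbase : Matrix.SpecialLinearGroup.map (Ideal.Quotient.mk (Q ^ (0 + 1))) (M ^ (2 * t)) = 1 := by
    rw [map_pow]
    apply pow_two_mul_eq_one_of_pow_mem_center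
    rw [← map_pow, ← reductionHom_eq_one_iff, map_pow, pow_orderOf_eq_one]
  have hind : ∀ i, Matrix.SpecialLinearGroup.map (Ideal.Quotient.mk (Q ^ (i + 1)))
      (M ^ (2 * t * p ^ i)) = 1 := by
    intro i
    induction i with
    | zero => simpa using hbase
    | succ i ih =>
      rw [pow_succ p, ← mul_assoc, pow_mul]
      exact map_pow_eq_one_of_map_eq_one hpQ ih
  have hred : ∀ i, reductionHom (Q ^ (i + 1)) (M ^ (2 * t * p ^ e)) = 1 := by
    intro i
    rw [map_pow, ← orderOf_dvd_iff_pow_eq_one]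
    refine dvd_mul_pow_of_not_pow_dvd (i := i) hp ?_ (hcon i)
    rw [orderOf_dvd_iff_pow_eq_one, ← map_pow, reductionHom_eq_one_iff, hind]
    exact Subgroup.one_mem _
  have hpos : 0 < 2 * t * p ^ e := by have := hp.pos; positivity
  exact (eq_one_or_eq_neg_one_of_reductionHom_eq_one hQ.ne_top hred).elim (hM _ hpos).1
    (hM _ hpos).2

lemma isCoprime_cyclotomic_X_pow_sub_one {F : Type*} [Field F] {N k : ℕ} (hN : (N : F) ≠ 0)
    (hk : ¬ N ∣ k) : IsCoprime (cyclotomic N F) (X ^ k - 1) := by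
  rw [isCoprime_iff_aeval_ne_zero_of_isAlgClosed F (AlgebraicClosure F)]
  intro a
  by_contra! ha
  have : NeZero (N : AlgebraicClosure F) := ⟨by
    rw [← map_natCast (algebraMap F (AlgebraicClosure F))]
    exact (_root_.map_ne_zero _).2 hN⟩
  have h1 : (cyclotomic N (AlgebraicClosure F)).IsRoot a := by
    have := ha.1
    rwa [aeval_def, ← eval_map, map_cyclotomic] at this
  have h2 : a ^ k = 1 := by
    have := ha.2
    simpa [sub_eq_zero] using this
  exact hk ((isRoot_cyclotomic_iff.1 h1).dvd_of_pow_eq_one _ h2)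

/-- If a cyclotomic polynomial `Φ_N` evaluated at a power of a matrix over a field is singular then
`N` divides twice the order of the matrix in `PSL(2)`. -/
lemma dvd_two_mul_orderOf_of_det_aeval_cyclotomic_eq_zero {A : Type} [CommRing A] {I : Ideal A}
    (hI : I.IsMaximal) {N : ℕ} (hN : (N : A) ∉ I)
    {M : Matrix.SpecialLinearGroup (Fin 2) A} {m : ℕ}
    (h : (aeval ((M : Matrix (Fin 2) (Fin 2) A) ^ m) (cyclotomic N A)).det ∈ I) :
    N ∣ 2 * orderOf (reductionHom I M) := by
  set t := orderOf (reductionHom I M) with ht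
  rcases Nat.eq_zero_or_pos t with ht0 | ht0
  · simp [ht0]
  by_contra hdvd
  set Y : Matrix (Fin 2) (Fin 2) (A ⧸ I) := (Ideal.Quotient.mk I).mapMatrix M with hY
  have hpow : Y ^ (2 * t) = 1 := by
    have : Matrix.SpecialLinearGroup.map (Ideal.Quotient.mk I) M ^ (2 * t) = 1 := by
      apply pow_two_mul_eq_one_of_pow_mem_center
      rw [← map_pow, ← reductionHom_eq_one_iff, map_pow, pow_orderOf_eq_one]
    have := congrArg Subtype.val this
    rwa [Matrix.SpecialLinearGroup.coe_pow] at this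
  have hNF : (N : A ⧸ I) ≠ 0 := by
    rw [← map_natCast (Ideal.Quotient.mk I)]
    exact fun h => hN (Ideal.Quotient.eq_zero_iff_mem.1 h)
  have hcop : IsCoprime (cyclotomic N (A ⧸ I)) (X ^ (2 * t) - 1) :=
    @isCoprime_cyclotomic_X_pow_sub_one _ (Ideal.Quotient.field I) _ _ hNF hdvd
  obtain ⟨u, v, huv⟩ := hcop
  have h1 : aeval (Y ^ m) u * aeval (Y ^ m) (cyclotomic N (A ⧸ I)) = 1 := by
    have := congrArg (aeval (Y ^ m)) huv
    have hz : (Y ^ m) ^ (2 * t) = 1 := by rw [← pow_mul, mul_comm, pow_mul, hpow, one_pow]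
    simpa [hz] using this
  have h2 : (aeval (Y ^ m) (cyclotomic N (A ⧸ I))).det = 0 := by
    rw [← Ideal.Quotient.eq_zero_iff_mem, RingHom.map_det] at h
    rw [← h, hY, ← map_pow, aeval_def, aeval_def, hom_eval₂, ← map_cyclotomic N (Ideal.Quotient.mk I),
      eval₂_map]
    congr 2
    ext a i j
    by_cases hij : i = j
    · subst hij; simp [Matrix.algebraMap_matrix_apply]
    · simp [Matrix.algebraMap_matrix_apply, hij]
  have h3 := congrArg Matrix.det h1
  rw [det_mul, h2, mul_zero, det_one] at h3
  exact zero_ne_one h3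

lemma pow_dvd_of_pow_succ_dvd_two_mul {p e t : ℕ} (hp : p.Prime) (h : p ^ (e + 1) ∣ 2 * t) :
    p ^ e ∣ t := by
  rcases hp.eq_two_or_odd' with rfl | hodd
  · rw [pow_succ'] at h
    exact Nat.dvd_of_mul_dvd_mul_left two_pos h
  · exact (pow_dvd_pow p e.le_succ).trans
      ((hodd.coprime_two_right.pow_left (e + 1)).dvd_of_dvd_mul_left h)

lemma det_aeval_conj_diagSL (P : SL2C) (r : ℂˣ) (f : ℂ[X]) :
    (aeval ((P * diagSL r * P⁻¹ : SL2C) : Matrix (Fin 2) (Fin 2) ℂ) f).det =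
      f.eval (r : ℂ) * f.eval ((r⁻¹ : ℂˣ) : ℂ) := by
  have h : aeval ((P * diagSL r * P⁻¹ : SL2C) : Matrix (Fin 2) (Fin 2) ℂ) f *
      (P : Matrix (Fin 2) (Fin 2) ℂ) = (P : Matrix (Fin 2) (Fin 2) ℂ) *
      !![f.eval (r : ℂ), 0; 0, f.eval ((r⁻¹ : ℂˣ) : ℂ)] := by
    induction f using Polynomial.induction_on' with
    | add f g hf hg =>
      rw [map_add, add_mul, hf, hg, ← mul_add]
      congr 1
      ext i j
      fin_cases i <;> fin_cases j <;> simp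
    | monomial n a =>
      have h1 : (P * diagSL r * P⁻¹) ^ n * P = P * diagSL (r ^ n) := by
        rw [conj_pow, map_pow, inv_mul_cancel_right]
      have h2 : ((P * diagSL r * P⁻¹ : SL2C) : Matrix (Fin 2) (Fin 2) ℂ) ^ n *
          (P : Matrix (Fin 2) (Fin 2) ℂ) = (P : Matrix (Fin 2) (Fin 2) ℂ) *
          (diagSL (r ^ n) : Matrix (Fin 2) (Fin 2) ℂ) := by
        simpa only [Matrix.SpecialLinearGroup.coe_mul, Matrix.SpecialLinearGroup.coe_pow] using
          congrArg Subtype.val h1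
      rw [aeval_monomial, mul_assoc, h2, coe_diagSL, ← Algebra.smul_def, ← Matrix.mul_smul]
      congr 1
      ext i j
      fin_cases i <;> fin_cases j <;> simp
  have hdet := congrArg Matrix.det h
  rw [det_mul, det_mul, P.det_coe, mul_one, one_mul, det_fin_two_of] at hdet
  rw [hdet]; ring

lemma isIntegral_of_add_inv {A B : Type*} [CommRing A] [Field B] [Algebra A B] {l : B}
    (hl : l ≠ 0) (h : IsIntegral A (l + l⁻¹)) : IsIntegral A l := by
  refine isIntegral_trans (A := integralClosure A B) l
    ⟨X ^ 2 - C (⟨l + l⁻¹, h⟩ : integralClosure A B) * X + 1, by monicity!, ?_⟩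
  have : algebraMap (integralClosure A B) B ⟨l + l⁻¹, h⟩ = l + l⁻¹ := rfl
  simp only [eval₂_add, eval₂_sub, eval₂_mul, eval₂_C, eval₂_X_pow, eval₂_X, eval₂_one, this]
  field_simp
  ring

lemma isIntegral_of_mem_subfield {k : Subfield ℂ} (hk : FiniteDimensional ℚ ↥k) {y : ℂ}
    (hy : y ∈ k) : IsIntegral ℚ y :=
  (IsIntegral.of_finite ℚ (⟨y, hy⟩ : k)).map k.subtype.toRatAlgHom

lemma exists_det_aeval_cyclotomic_not_isUnit {R : Subring ℂ} (hR : IsFGSubringOfNumberField R)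
    {M : Matrix.SpecialLinearGroup (Fin 2) R} {P : SL2C} {r : ℂˣ} (hr : ‖(r : ℂ)‖ ≠ 1)
    (hM : Matrix.SpecialLinearGroup.map R.subtype M = P * diagSL r * P⁻¹) {N : ℕ} (hN : 1 < N) :
    ∃ m : ℕ, (aeval ((M : Matrix (Fin 2) (Fin 2) R) ^ m) (cyclotomic N R)).det ≠ 0 ∧
      ¬ IsUnit (aeval ((M : Matrix (Fin 2) (Fin 2) R) ^ m) (cyclotomic N R)).det := by
  obtain ⟨⟨s, hs⟩, k, hk, hRk⟩ := hR
  set D : ℕ → R := fun m => (aeval ((M : Matrix (Fin 2) (Fin 2) R) ^ m) (cyclotomic N R)).det with hD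
  have hDval : ∀ m, (D m : ℂ) = (cyclotomic N ℂ).eval ((r : ℂ) ^ m) *
      (cyclotomic N ℂ).eval (((r : ℂ) ^ m)⁻¹) := by
    intro m
    have h1 := det_aeval_conj_diagSL P (r ^ m) (cyclotomic N ℂ)
    have h2 : (P * diagSL (r ^ m) * P⁻¹ : SL2C) =
        Matrix.SpecialLinearGroup.map R.subtype (M ^ m) := by
      rw [map_pow, map_pow, hM, conj_pow]
    rw [h2] at h1
    have h3 : ((Matrix.SpecialLinearGroup.map R.subtype (M ^ m) : SL2C) :
        Matrix (Fin 2) (Fin 2) ℂ) = R.subtype.mapMatrix ((M : Matrix (Fin 2) (Fin 2) R) ^ m) := rfl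
    rw [h3] at h1
    simp only [← inv_pow, Units.val_pow_eq_pow_val, Units.val_inv_eq_inv_val] at h1
    rw [inv_pow] at h1
    rw [← h1]
    change R.subtype (D m) = _
    rw [hD, RingHom.map_det, aeval_def, aeval_def, hom_eval₂, ← map_cyclotomic N R.subtype,
      eval₂_map]
    congr 2
    ext a i j
    by_cases hij : i = j
    · subst hij; simp [Matrix.algebraMap_matrix_apply]
    · simp [Matrix.algebraMap_matrix_apply, hij]
  have hsk : ∀ y ∈ s, y ∈ k := fun y hy => hRk (hs ▸ Subring.subset_closure hy)
  have hrint : IsIntegral ℚ (r : ℂ) := by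
    refine isIntegral_of_add_inv r.ne_zero ?_
    have htr : ((M 0 0 + M 1 1 : R) : ℂ) = (r : ℂ) + (r : ℂ)⁻¹ := by
      have h1 := congrArg (fun Z : SL2C => Matrix.trace (Z : Matrix (Fin 2) (Fin 2) ℂ)) hM
      have h2 : Matrix.trace ((P * diagSL r * P⁻¹ : SL2C) : Matrix (Fin 2) (Fin 2) ℂ) =
          (r : ℂ) + (r : ℂ)⁻¹ := by
        rw [Matrix.SpecialLinearGroup.coe_mul, Matrix.trace_mul_comm,
          ← Matrix.SpecialLinearGroup.coe_mul, inv_mul_cancel_left, coe_diagSL]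
        simp
      rw [← h2, ← h1, trace_fin_two]
      simp
    rw [← htr]
    exact isIntegral_of_mem_subfield hk (hRk (M 0 0 + M 1 1).2)
  set S : Set ℂ := insert (r : ℂ) s with hS
  have hSfin : S.Finite := s.finite_toSet.insert _
  have hSint : ∀ y ∈ S, IsIntegral ℚ y := by
    rintro y (rfl | hy)
    · exact hrint
    · exact isIntegral_of_mem_subfield hk (hsk y hy)
  let K := IntermediateField.adjoin ℚ S
  have : Finite S := hSfin
  have : FiniteDimensional ℚ K := IntermediateField.finiteDimensional_adjoin hSint
  have : NumberField K := ⟨⟩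
  let φ : K →+* ℂ := K.val.toRingHom
  have hφ : Function.Injective φ := φ.injective
  let x : K := ⟨r, IntermediateField.subset_adjoin _ _ (Set.mem_insert _ _)⟩
  have hx0 : x ≠ 0 := fun h => r.ne_zero (congrArg Subtype.val h)
  have hxn : ‖φ x‖ ≠ 1 := hr
  obtain ⟨m, w, hm, hw, hlt⟩ := exists_finitePlace_eval_cyclotomic_lt_one φ hx0 hxn
    (φ ⁻¹' s) (s.finite_toSet.preimage hφ.injOn) hN
  have hDφ : (D m : ℂ) = φ ((cyclotomic N K).eval (x ^ m) * (cyclotomic N K).eval ((x ^ m)⁻¹)) := by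
    rw [hDval, map_mul, ← eval_map_apply, ← eval_map_apply, map_cyclotomic, map_inv₀, map_pow]
    rfl
  have hpow : ‖φ (x ^ m)‖ ≠ 1 := by
    intro h
    rw [map_pow, norm_pow] at h
    exact hxn ((pow_eq_one_iff_of_nonneg (norm_nonneg _) hm.ne').1 h)
  have hpow' : ‖φ (x ^ m)⁻¹‖ ≠ 1 := by
    rw [map_inv₀, norm_inv]; simpa using hpow
  refine ⟨m, ?_, ?_⟩
  · intro h0
    have h0' : (D m : ℂ) = 0 := by rw [hD]; simp only [h0]; rfl
    rw [hDφ, map_eq_zero] at h0'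
    exact mul_ne_zero (eval_cyclotomic_ne_zero φ hpow hN) (eval_cyclotomic_ne_zero φ hpow' hN) h0'
  · rintro hu
    obtain ⟨d, hd⟩ := hu.exists_right_inv
    let O : Subring K :=
      { carrier := {y | w y ≤ 1}
        mul_mem' := fun {a b} ha hb => by
          simp only [Set.mem_ofPred_eq, map_mul] at *
          exact mul_le_one₀ ha (apply_nonneg _ _) hb
        one_mem' := by simp
        add_mem' := fun {a b} ha hb => (FinitePlace.add_le w a b).trans (max_le ha hb)
        zero_mem' := by simp
        neg_mem' := fun {a} ha => by
          have : w (-a) = w a := map_neg_eq_map w.1 a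
          simpa [this] using ha }
    have hRO : R ≤ O.map φ := by
      rw [hs, Subring.closure_le]
      intro y hy
      exact ⟨⟨y, IntermediateField.subset_adjoin _ _ (Set.mem_insert_of_mem _ hy)⟩,
        hw _ hy, rfl⟩
    obtain ⟨d', hd'O, hd'⟩ := hRO d.2
    have hprod : ((cyclotomic N K).eval (x ^ m) * (cyclotomic N K).eval ((x ^ m)⁻¹)) * d' = 1 := by
      apply hφ
      rw [map_mul, ← hDφ, hd', map_one]
      exact congrArg Subtype.val hd
    have hw1 := congrArg w hprod
    rw [map_mul, map_one] at hw1
    exact absurd hw1 (mul_lt_one_of_nonneg_of_lt_one_left (apply_nonneg _ _) hlt hd'O).ne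

lemma diagSL_neg (r : ℂˣ) : diagSL (-r) = -diagSL r := by
  apply Subtype.ext
  rw [Matrix.SpecialLinearGroup.coe_neg, coe_diagSL, coe_diagSL]
  ext i j
  fin_cases i <;> fin_cases j <;> simp

lemma eq_conj_diagSL_of_mk_eq_torus {P A : SL2C} {r : ℂˣ}
    (h : (QuotientGroup.mk A : PSL2C) = torus P r) :
    ∃ r' : ℂˣ, ‖(r' : ℂ)‖ = ‖(r : ℂ)‖ ∧ A = P * diagSL r' * P⁻¹ := by
  rw [torus_apply, mk_eq_mk_iff] at h
  rcases h with h | h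
  · exact ⟨r, rfl, h⟩
  · refine ⟨-r, by simp, ?_⟩
    rw [h, diagSL_neg, mul_neg, neg_mul]

lemma norm_eq_of_torus_eq {P : SL2C} {r r' : ℂˣ} (h : torus P r = torus P r') :
    ‖(r : ℂ)‖ = ‖(r' : ℂ)‖ := by
  rw [torus_apply] at h
  obtain ⟨r'', hn, he⟩ := eq_conj_diagSL_of_mk_eq_torus h
  have h1 : diagSL r = diagSL r'' := mul_left_cancel (mul_right_cancel he)
  have h2 : (r : ℂ) = r'' := congrFun (congrFun (congrArg Subtype.val h1) 0) 0
  rw [h2, hn]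

/-- The order of a loxodromic element is divisible by arbitrary prime powers modulo suitable
ideals. -/
lemma exists_pow_dvd_orderOf_reductionHom {R : Subring ℂ} (hR : IsFGSubringOfNumberField R)
    {M : Matrix.SpecialLinearGroup (Fin 2) R} {P : SL2C} {r : ℂˣ} (hr : ‖(r : ℂ)‖ ≠ 1)
    (hM : Matrix.SpecialLinearGroup.map R.subtype M = P * diagSL r * P⁻¹) {p : ℕ} (hp : p.Prime)
    (e : ℕ) : ∃ I : Ideal R, I ≠ ⊥ ∧ p ^ e ∣ orderOf (reductionHom I M) := by
  by_cases hpu : IsUnit (p : R)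
  · obtain ⟨m, hm0, hmu⟩ := exists_det_aeval_cyclotomic_not_isUnit hR hr hM
      (Nat.one_lt_pow e.succ_ne_zero hp.one_lt)
    obtain ⟨I, hI, hmI⟩ := exists_max_ideal_of_mem_nonunits hmu
    refine ⟨I, ?_, pow_dvd_of_pow_succ_dvd_two_mul hp
      (dvd_two_mul_orderOf_of_det_aeval_cyclotomic_eq_zero hI ?_ hmI)⟩
    · rintro rfl
      exact hm0 (Ideal.mem_bot.1 hmI)
    · intro h
      rw [Nat.cast_pow] at h
      exact hI.ne_top (Ideal.eq_top_of_isUnit_mem _ h (hpu.pow _))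
  · have : IsNoetherianRing R := by
      obtain ⟨⟨s, rfl⟩, -⟩ := hR
      exact is_noetherian_subring_closure _ s.finite_toSet
    refine exists_pow_dvd_orderOf_reductionHom_of_not_isUnit hp hpu
      (Nat.cast_ne_zero.2 hp.ne_zero) (fun n hn => ?_) e
    have key : ∀ Z : Matrix.SpecialLinearGroup (Fin 2) R, Z = 1 ∨ Z = -1 → M ^ n ≠ Z := by
      rintro Z hZ rfl
      have h1 : torus P (r ^ n) = torus P 1 := by
        have h2 : torus P (r ^ n) =
            QuotientGroup.mk (Matrix.SpecialLinearGroup.map R.subtype (M ^ n)) := by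
          rw [torus_apply, map_pow, map_pow, hM, conj_pow]
        rw [h2, map_one, ← QuotientGroup.mk_one, mk_eq_mk_iff]
        exact hZ.imp (fun h => by rw [h, map_one])
          (fun h => by rw [h, map_neg_one_specialLinearGroup])
      have h2 := norm_eq_of_torus_eq h1
      rw [Units.val_pow_eq_pow_val, norm_pow, Units.val_one, norm_one] at h2
      exact hr ((pow_eq_one_iff_of_nonneg (norm_nonneg _) hn.ne').1 h2)
    exact ⟨key 1 (Or.inl rfl), key (-1) (Or.inr rfl)⟩

lemma exists_reductionHom_ne_one {R : Subring ℂ} (hR : IsFGSubringOfNumberField R)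
    {d : R} (hd0 : d ≠ 0) (hdu : ¬ IsUnit d)
    {M : Matrix.SpecialLinearGroup (Fin 2) R} (h1 : M ≠ 1) (h2 : M ≠ -1) :
    ∃ I : Ideal R, I ≠ ⊥ ∧ reductionHom I M ≠ 1 := by
  have : IsNoetherianRing R := by
    obtain ⟨⟨s, rfl⟩, -⟩ := hR
    exact is_noetherian_subring_closure _ s.finite_toSet
  obtain ⟨Q, hQ, hdQ⟩ := exists_max_ideal_of_mem_nonunits hdu
  have hQ0 : Q ≠ ⊥ := by rintro rfl; exact hd0 (Ideal.mem_bot.1 hdQ)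
  by_contra! hcon
  exact (eq_one_or_eq_neg_one_of_reductionHom_eq_one hQ.ne_top
    fun i => hcon _ (pow_ne_zero (i + 1) hQ0)).elim h1 h2

/-- In a torsion-free group, commuting elements with a common power generate a cyclic group. -/
lemma exists_common_root {G : Type*} [Group G] (htf : ∀ x : G, IsOfFinOrder x → x = 1)
    {x g : G} (hc : Commute g x) {a : ℕ} (ha : 0 < a) {b : ℤ} (h : g ^ a = x ^ b) :
    ∃ (n : ℕ) (m u v : ℤ), 0 < n ∧ x = (x ^ u * g ^ v) ^ n ∧ g = (x ^ u * g ^ v) ^ m := by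
  set d := Int.gcd a b with hd
  have hd0 : 0 < d := Int.gcd_pos_of_ne_zero_left _ (by exact_mod_cast ha.ne')
  obtain ⟨a', b', hcop, hab, hb⟩ := Int.exists_gcd_one hd0
  lift a' to ℕ using by
    by_contra! h0
    have : (0 : ℤ) < a := by exact_mod_cast ha
    rw [hab] at this
    exact absurd this (not_lt.2 (mul_nonpos_of_nonpos_of_nonneg h0.le (by positivity)))
  have hroot : g ^ (a' : ℤ) = x ^ b' := by
    rw [← mul_inv_eq_one]
    apply htf
    rw [isOfFinOrder_iff_pow_eq_one]
    refine ⟨d, hd0, ?_⟩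
    rw [← _root_.zpow_neg, ((hc.zpow_left _).zpow_right _).mul_pow, ← zpow_natCast, ← zpow_natCast,
      ← _root_.zpow_mul, ← _root_.zpow_mul, ← hab, zpow_natCast, neg_mul, ← hb, _root_.zpow_neg, h,
      mul_inv_cancel]
  have ha' : 0 < a' := by
    rw [Nat.pos_iff_ne_zero]
    rintro rfl
    simp at hab
    omega
  have hbez : (1 : ℤ) = a' * Int.gcdA a' b' + b' * Int.gcdB a' b' := by
    rw [← Int.gcd_eq_gcd_ab, hcop]; rfl
  set u := Int.gcdA a' b'
  set v := Int.gcdB a' b'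
  have hcuv : Commute (x ^ u) (g ^ v) := (hc.symm.zpow_left _).zpow_right _
  refine ⟨a', b', u, v, ha', ?_, ?_⟩
  · rw [← zpow_natCast, hcuv.mul_zpow, ← _root_.zpow_mul, ← _root_.zpow_mul, mul_comm v,
      _root_.zpow_mul g, hroot, ← _root_.zpow_mul, ← _root_.zpow_add, mul_comm u, ← hbez, zpow_one]
  · rw [hcuv.mul_zpow, ← _root_.zpow_mul, ← _root_.zpow_mul, mul_comm u,
      _root_.zpow_mul x, ← hroot, ← _root_.zpow_mul, ← _root_.zpow_add, mul_comm v, ← hbez, zpow_one]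

end Helpers

/-- Let `Γ ≤ PSL(2, ℂ)` be a torsion-free discrete subgroup of finite covolume
contained in `PSL(2, R)`, where `R` is a finitely generated subring of a number field.
Then every infinite cyclic subgroup `H` of `Γ` generated by a loxodromic element is
closed in the congruence topology on `Γ`. -/
theorem loxodromic_cyclic_subgroup_congruence_closed
    (Γ : Subgroup PSL2C) (hdisc : DiscreteTopology ↥Γ) (hvol : HasFiniteCovolume Γ)
    (htf : ∀ x : ↥Γ, IsOfFinOrder x → x = 1)
    (R : Subring ℂ) (hR : IsFGSubringOfNumberField R) (hΓR : ContainedInPSL2 R Γ)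
    (H : Subgroup ↥Γ) (hH : IsLoxodromicSubgroup Γ H) :
    CongruenceClosed R Γ (H : Set ↥Γ) := by
  obtain ⟨x, hx, -, rfl⟩ := hH
  intro γ hγ
  obtain ⟨P, μ, hμ, hxP, hcent⟩ := hx.exists_torus
  suffices h : ∃ I : Ideal R, I ≠ ⊥ ∧ ∀ η : ↥Γ →* PSL2 (↥R ⧸ I),
      (∀ (x : ↥Γ) (A : Matrix.SpecialLinearGroup (Fin 2) ↥R),
        (QuotientGroup.mk (Matrix.SpecialLinearGroup.map R.subtype A) : PSL2C) = (x : PSL2C) →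
        η x = reductionHom I A) → ∀ i : ℤ, η γ ≠ η x ^ i by
    obtain ⟨I, hI, h⟩ := h
    obtain ⟨η, hη⟩ := exists_congruenceHom hΓR I
    refine ⟨I, hI, η, hη, ?_⟩
    rintro ⟨y, hy, hyγ⟩
    obtain ⟨i, rfl⟩ := Subgroup.mem_zpowers_iff.1 hy
    exact h η hη i (by rw [← hyγ, map_zpow])
  by_cases hcomm : γ * x = x * γ
  · obtain ⟨ν, hν⟩ := hcent γ (congrArg Subtype.val hcomm)
    obtain ⟨a, ha, b, hab⟩ := exists_pow_eq_zpow_of_discrete Γ hdisc P hμ hxP hν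
    obtain ⟨n, m, u, v, hn, hxz, hγz⟩ := exists_common_root htf hcomm ha hab
    have hzP : ((x ^ u * γ ^ v : Γ) : PSL2C) = torus P (μ ^ u * ν ^ v) := by
      simp [hxP, hν]
    generalize x ^ u * γ ^ v = z at *
    generalize μ ^ u * ν ^ v = r at *
    have hr : ‖(r : ℂ)‖ ≠ 1 := by
      intro h1
      have h2 : torus P μ = torus P (r ^ n) := by
        rw [map_pow, ← hzP, ← hxP, hxz]; rfl
      rw [norm_eq_of_torus_eq h2, Units.val_pow_eq_pow_val, norm_pow, h1, one_pow] at hμ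
      exact hμ rfl
    obtain ⟨B, hB⟩ := hΓR z
    obtain ⟨r', hr', hBr⟩ := eq_conj_diagSL_of_mk_eq_torus (hB.trans hzP)
    have hnm : ¬ n ∣ m.natAbs := by
      intro h
      obtain ⟨c, hc⟩ := Int.natCast_dvd.2 h
      refine hγ (Subgroup.mem_zpowers_iff.2 ⟨c, ?_⟩)
      rw [hγz, hxz, hc, _root_.zpow_mul, zpow_natCast]
    rw [Nat.dvd_iff_prime_pow_dvd_dvd] at hnm
    push Not at hnm
    obtain ⟨p, e, hp, hpn, hpm⟩ := hnm
    obtain ⟨I, hI, hdvd⟩ := exists_pow_dvd_orderOf_reductionHom hR (hr' ▸ hr) hBr hp e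
    refine ⟨I, hI, fun η hη i hi => hpm ?_⟩
    rw [hγz, hxz, map_zpow, map_pow, hη z B hB, ← zpow_natCast, ← _root_.zpow_mul,
      ← mul_inv_eq_one, ← _root_.zpow_neg, ← _root_.zpow_add, ← orderOf_dvd_iff_zpow_eq_one] at hi
    have h1 : ((p ^ e : ℕ) : ℤ) ∣ m + -(n * i) := (Int.natCast_dvd_natCast.2 hdvd).trans hi
    have h2 : ((p ^ e : ℕ) : ℤ) ∣ n * i := (Int.natCast_dvd_natCast.2 hpn).mul_right i
    exact Int.natCast_dvd.1 ((Int.dvd_add_left (Int.dvd_neg.2 h2)).1 h1)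
  · obtain ⟨A, hA⟩ := hΓR x
    obtain ⟨r, hr, hAr⟩ := eq_conj_diagSL_of_mk_eq_torus (hA.trans hxP)
    obtain ⟨m, hd0, hdu⟩ := exists_det_aeval_cyclotomic_not_isUnit hR (hr ▸ hμ) hAr one_lt_two
    obtain ⟨C, hC⟩ := hΓR (γ * x * (x * γ)⁻¹)
    have hC1 : ∀ Z, Z = 1 ∨ Z = -1 → C ≠ Z := by
      rintro Z hZ rfl
      apply hcomm
      rw [← mul_inv_eq_one]
      apply Subtype.ext
      rw [← hC, Subgroup.coe_one, ← QuotientGroup.mk_one, mk_eq_mk_iff]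
      exact hZ.imp (fun h => by rw [h, map_one])
        (fun h => by rw [h, map_neg_one_specialLinearGroup])
    obtain ⟨I, hI, hIC⟩ := exists_reductionHom_ne_one hR hd0 hdu (hC1 1 (Or.inl rfl))
      (hC1 (-1) (Or.inr rfl))
    refine ⟨I, hI, fun η hη i hi => hIC ?_⟩
    rw [← hη _ C hC, map_mul, map_inv, map_mul, map_mul, hi, mul_inv_eq_one]
    exact ((Commute.refl (η x)).zpow_left i).eq
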